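/- Let a, b : ℝ × ℝ → ℝ be smooth and suppose that for every T > 0 there is C_T > 0 with |a(t,x)| ≤ C_T|x| for all |x| ≥ 1 and t ∈ [−T,T]. Then for every smooth ψ : ℝ → ℝ there exists a unique smooth global solution u : ℝ × ℝ → ℝ of u_t = a uₓ + b u with u(0,·) = ψ. Moreover, if ψ > 0 everywhere then u > 0 everywhere. -/

import Mathlib

/-- Partial derivative in the space variable. -/
noncomputable def pdx (f : ℝ → ℝ → ℝ) (t x : ℝ) : ℝ := deriv (f t) x

/-- Partial derivative in the time variable. -/
noncomputable def pdt (f : ℝ → ℝ → ℝ) (t x : ℝ) : ℝ := deriv (fun s => f s x) t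

open Set Filter Topology MeasureTheory
open scoped NNReal

/-- A function of two real variables whose partial derivatives are `C^n` is `C^(n+1)`. -/
theorem contDiff_succ_of_partials {n : ℕ} {F F₁ F₂ : ℝ → ℝ → ℝ}
    (h₁ : ∀ t x, HasDerivAt (fun s => F s x) (F₁ t x) t)
    (h₂ : ∀ t x, HasDerivAt (F t) (F₂ t x) x)
    (c₁ : ContDiff ℝ n (fun p : ℝ × ℝ => F₁ p.1 p.2))
    (c₂ : ContDiff ℝ n (fun p : ℝ × ℝ => F₂ p.1 p.2)) :
    ContDiff ℝ (n + 1 : ℕ) (fun p : ℝ × ℝ => F p.1 p.2) := by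
  have key := fun u : ℝ × ℝ => hasStrictFDerivAt_uncurry_coprod (u := u) (f := F)
    (f₁ := fun t x => ContinuousLinearMap.toSpanSingleton ℝ (F₁ t x))
    (f₂ := fun t x => ContinuousLinearMap.toSpanSingleton ℝ (F₂ t x))
    (Eventually.of_forall fun v => (h₁ v.1 v.2).hasFDerivAt)
    (Eventually.of_forall fun v => (h₂ v.1 v.2).hasFDerivAt)
    ((ContinuousLinearMap.toSpanSingletonCLE (𝕜 := ℝ) (E := ℝ)).continuous.comp
      c₁.continuous).continuousAt
    ((ContinuousLinearMap.toSpanSingletonCLE (𝕜 := ℝ) (E := ℝ)).continuous.comp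
      c₂.continuous).continuousAt
  rw [Nat.cast_add, Nat.cast_one, contDiff_succ_iff_hasFDerivAt]
  refine ⟨fun p => F₁ p.1 p.2 • ContinuousLinearMap.fst ℝ ℝ ℝ
    + F₂ p.1 p.2 • ContinuousLinearMap.snd ℝ ℝ ℝ,
    (c₁.smul contDiff_const).add (c₂.smul contDiff_const), fun u => ?_⟩
  convert! (key u).hasFDerivAt using 1
  ext <;> simp [Function.HasUncurry.uncurry]

theorem hasDerivAt_snd_fderiv {f : ℝ → ℝ → ℝ}
    (hf : ContDiff ℝ 1 (fun p : ℝ × ℝ => f p.1 p.2)) (t x : ℝ) :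
    HasDerivAt (f t) (fderiv ℝ (fun p : ℝ × ℝ => f p.1 p.2) (t, x) (0, 1)) x :=
  ((hf.differentiable one_ne_zero) (t, x)).hasFDerivAt.comp_hasDerivAt x
    ((hasDerivAt_const x t).prodMk (hasDerivAt_id x))

theorem contDiff_deriv_snd {m n : WithTop ℕ∞} {f : ℝ → ℝ → ℝ}
    (hf : ContDiff ℝ n (fun p : ℝ × ℝ => f p.1 p.2)) (hmn : m + 1 ≤ n) :
    ContDiff ℝ m (fun p : ℝ × ℝ => deriv (f p.1) p.2) := by
  have h1 : ContDiff ℝ 1 (fun p : ℝ × ℝ => f p.1 p.2) := hf.of_le (le_add_self.trans hmn)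
  simp_rw [fun p : ℝ × ℝ => (hasDerivAt_snd_fderiv h1 p.1 p.2).deriv]
  exact (hf.fderiv_right hmn).clm_apply contDiff_const

theorem hasDerivAt_intervalIntegral_param {g : ℝ → ℝ → ℝ}
    (hg : ContDiff ℝ 1 (fun p : ℝ × ℝ => g p.1 p.2)) (t x : ℝ) :
    HasDerivAt (fun y => ∫ s in (0 : ℝ)..t, g s y) (∫ s in (0 : ℝ)..t, deriv (g s) x) x := by
  have hc : Continuous (fun p : ℝ × ℝ => deriv (g p.1) p.2) :=
    (contDiff_deriv_snd (m := 0) hg (by simp)).continuous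
  have hg1 : ∀ y, Continuous fun s => g s y := fun y =>
    hg.continuous.comp (f := fun s => (s, y)) (by fun_prop)
  have hg2 : Continuous fun s => deriv (g s) x :=
    hc.comp (g := fun p : ℝ × ℝ => deriv (g p.1) p.2) (f := fun s => (s, x)) (by fun_prop)
  obtain ⟨B, hB⟩ := (isCompact_uIcc.prod (isCompact_closedBall x 1)).exists_bound_of_continuousOn
    (s := uIcc 0 t ×ˢ Metric.closedBall x 1) hc.continuousOn
  refine (intervalIntegral.hasDerivAt_integral_of_dominated_loc_of_deriv_le
    (F := fun y s => g s y) (F' := fun y s => deriv (g s) y) (bound := fun _ => B)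
    (Metric.closedBall_mem_nhds x one_pos)
    (Eventually.of_forall fun y => (hg1 y).aestronglyMeasurable)
    ((hg1 x).intervalIntegrable _ _) hg2.aestronglyMeasurable
    (Eventually.of_forall fun s hs y hy => hB (s, y) ⟨uIoc_subset_uIcc hs, hy⟩)
    intervalIntegrable_const
    (Eventually.of_forall fun s _ y _ => ?_)).2
  exact (hasDerivAt_snd_fderiv hg s y).differentiableAt.hasDerivAt

theorem contDiff_primitive {n : ℕ} {g : ℝ → ℝ → ℝ}
    (hg : ContDiff ℝ n (fun p : ℝ × ℝ => g p.1 p.2)) :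
    ContDiff ℝ n (fun p : ℝ × ℝ => ∫ s in (0 : ℝ)..p.1, g s p.2) := by
  induction n generalizing g with
  | zero =>
    rw [Nat.cast_zero, contDiff_zero] at hg ⊢
    exact intervalIntegral.continuous_parametric_intervalIntegral_of_continuous
      (f := fun (p : ℝ × ℝ) s => g s p.2)
      (hg.comp (f := fun q : (ℝ × ℝ) × ℝ => (q.2, q.1.2)) (by fun_prop)) continuous_fst
  | succ n ih =>
    have h1 : ContDiff ℝ 1 (fun p : ℝ × ℝ => g p.1 p.2) := hg.of_le (by simp)
    refine contDiff_succ_of_partials (F := fun t x => ∫ s in (0 : ℝ)..t, g s x)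
      (F₁ := g) (F₂ := fun t x => ∫ s in (0 : ℝ)..t, deriv (g s) x)
      (fun t x => ?_) (hasDerivAt_intervalIntegral_param h1) (hg.of_le (by simp))
      (ih (contDiff_deriv_snd hg (by simp)))
    have : Continuous fun s => g s x := hg.continuous.comp (f := fun s => (s, x)) (by fun_prop)
    exact intervalIntegral.integral_hasDerivAt_right
      (this.intervalIntegrable _ _) (this.stronglyMeasurableAtFilter _ _) this.continuousAt

/-- Hadamard's lemma in the second variable. -/
theorem exists_continuous_slope {f : ℝ → ℝ → ℝ}
    (hf : ContDiff ℝ 1 (fun p : ℝ × ℝ => f p.1 p.2)) :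
    ∃ A : ℝ → ℝ → ℝ → ℝ, Continuous (fun p : ℝ × ℝ × ℝ => A p.1 p.2.1 p.2.2) ∧
      (∀ t p q, f t p - f t q = A t p q * (p - q)) ∧ ∀ t p, A t p p = deriv (f t) p := by
  have hc : Continuous (fun p : ℝ × ℝ => deriv (f p.1) p.2) :=
    (contDiff_deriv_snd (m := 0) hf (by simp)).continuous
  refine ⟨fun t p q => ∫ θ in (0 : ℝ)..1, deriv (f t) (q + θ * (p - q)), ?_, fun t p q => ?_,
    fun t p => by simp⟩
  · exact intervalIntegral.continuous_parametric_intervalIntegral_of_continuous'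
      (f := fun (z : ℝ × ℝ × ℝ) θ => deriv (f z.1) (z.2.2 + θ * (z.2.1 - z.2.2)))
      (hc.comp (f := fun w : (ℝ × ℝ × ℝ) × ℝ =>
        (w.1.1, w.1.2.2 + w.2 * (w.1.2.1 - w.1.2.2))) (by fun_prop)) _ _
  · have hd : ∀ θ ∈ uIcc (0 : ℝ) 1, HasDerivAt (fun θ => f t (q + θ * (p - q)))
        (deriv (f t) (q + θ * (p - q)) * (p - q)) θ := fun θ _ =>
      ((hasDerivAt_snd_fderiv hf t (q + θ * (p - q))).differentiableAt.hasDerivAt).comp θ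
        (by simpa using ((hasDerivAt_id θ).mul_const (p - q)).const_add q)
    have hcont : Continuous fun θ : ℝ => deriv (f t) (q + θ * (p - q)) * (p - q) :=
      (hc.comp (f := fun θ : ℝ => (t, q + θ * (p - q))) (by fun_prop)).mul continuous_const
    have := intervalIntegral.integral_eq_sub_of_hasDerivAt hd (hcont.intervalIntegrable _ _)
    rw [intervalIntegral.integral_mul_const] at this
    simpa using this.symm

/-- Solutions of a scalar linear equation `w' = c w`. -/
theorem eq_mul_exp_of_hasDerivAt {w c : ℝ → ℝ} (hc : Continuous c)
    (hw : ∀ t, HasDerivAt w (c t * w t) t) (t₀ t : ℝ) :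
    w t = w t₀ * Real.exp (∫ s in t₀..t, c s) := by
  have hI : ∀ t, HasDerivAt (fun t => ∫ s in t₀..t, c s) (c t) t := fun t =>
    intervalIntegral.integral_hasDerivAt_right
      (hc.intervalIntegrable _ _) (hc.stronglyMeasurableAtFilter _ _) hc.continuousAt
  have hd : ∀ t, HasDerivAt (fun t => w t * Real.exp (-∫ s in t₀..t, c s)) 0 t := fun t => by
    convert! (hw t).mul (hI t).neg.exp using 1
    simp only [Pi.neg_apply]
    ring
  have h := is_const_of_deriv_eq_zero (fun t => (hd t).differentiableAt)
    (fun t => (hd t).deriv) t t₀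
  simp only [intervalIntegral.integral_same, neg_zero, Real.exp_zero, mul_one] at h
  rw [← h, mul_assoc, ← Real.exp_add]
  simp

/-- The inverse of a bijective smooth map with invertible derivatives is smooth. -/
theorem contDiff_inverse {E : Type*} [NormedAddCommGroup E] [NormedSpace ℝ E] [CompleteSpace E]
    {n : WithTop ℕ∞} (hn : n ≠ 0) {Φ Z : E → E} (hΦ : ContDiff ℝ n Φ)
    (hl : Function.LeftInverse Z Φ) (hr : Function.RightInverse Z Φ)
    (hd : ∀ x, ∃ L : E ≃L[ℝ] E, HasFDerivAt Φ (L : E →L[ℝ] E) x) : ContDiff ℝ n Z := by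
  rw [contDiff_iff_contDiffAt]
  intro y
  obtain ⟨x, rfl⟩ := hr.surjective y
  obtain ⟨L, hL⟩ := hd x
  have hx := hΦ.contDiffAt (x := x)
  refine (hx.to_localInverse hL hn).congr_of_eventuallyEq ?_
  filter_upwards [(hx.hasStrictFDerivAt' hL hn).eventually_right_inverse] with p hp
  rw [← hl (hx.localInverse hL hn p)]
  exact congrArg Z hp.symm

/-- The derivative of a function along a curve. -/
theorem hasDerivAt_along {v : ℝ → ℝ → ℝ} (hv : ContDiff ℝ 1 (fun p : ℝ × ℝ => v p.1 p.2))
    {γ : ℝ → ℝ} {γ' t : ℝ} (hγ : HasDerivAt γ γ' t) :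
    HasDerivAt (fun s => v s (γ s)) (pdt v t (γ t) + pdx v t (γ t) * γ') t := by
  have hd := ((hv.differentiable one_ne_zero) (t, γ t)).hasFDerivAt
  have h1 : pdt v t (γ t) = fderiv ℝ (fun p : ℝ × ℝ => v p.1 p.2) (t, γ t) (1, 0) :=
    HasDerivAt.deriv (hd.comp_hasDerivAt (f := fun s => (s, γ t)) t
      ((hasDerivAt_id t).prodMk (hasDerivAt_const t (γ t))))
  have h2 : pdx v t (γ t) = fderiv ℝ (fun p : ℝ × ℝ => v p.1 p.2) (t, γ t) (0, 1) :=
    (hasDerivAt_snd_fderiv hv t (γ t)).deriv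
  convert! hd.comp_hasDerivAt (f := fun s => (s, γ s)) t ((hasDerivAt_id t).prodMk hγ) using 1
  have : ((1, γ') : ℝ × ℝ) = (1, 0) + γ' • (0, 1) := by simp
  rw [this, map_add, map_smul, h1, h2, smul_eq_mul, mul_comm]

/-- Time-dependent vector fields on the line with locally uniform at most linear growth. -/
def LinearGrowth (f : ℝ → ℝ → ℝ) : Prop :=
  ∀ T : ℝ, ∃ C : ℝ, 0 ≤ C ∧ ∀ t x : ℝ, t ∈ Icc (-T) T → |f t x| ≤ C * (1 + |x|)

theorem LinearGrowth.of_bound {f : ℝ → ℝ → ℝ}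
    (hf : Continuous (fun p : ℝ × ℝ => f p.1 p.2))
    (h : ∀ T : ℝ, 0 < T → ∃ C : ℝ, 0 < C ∧
      ∀ t x : ℝ, t ∈ Icc (-T) T → 1 ≤ |x| → |f t x| ≤ C * |x|) : LinearGrowth f := by
  intro T
  have hT : 0 < max T 1 := lt_max_of_lt_right one_pos
  obtain ⟨C, hC, hb⟩ := h _ hT
  obtain ⟨D, hD⟩ := (isCompact_Icc.prod isCompact_Icc).exists_bound_of_continuousOn
    (s := Icc (-max T 1) (max T 1) ×ˢ Icc (-1 : ℝ) 1) hf.continuousOn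
  have hD0 : 0 ≤ D := (norm_nonneg _).trans (hD (0, 0) (by simp))
  refine ⟨C + D, by positivity, fun t x ht => ?_⟩
  replace ht := Icc_subset_Icc (neg_le_neg (le_max_left T 1)) (le_max_left T 1) ht
  rcases le_total 1 |x| with hx | hx
  · nlinarith [hb t x ht hx]
  · have := hD (t, x) ⟨ht, abs_le.1 hx⟩
    rw [Real.norm_eq_abs] at this
    nlinarith [abs_nonneg x]

/-- A priori bound for curves whose velocity grows at most linearly. -/
theorem abs_le_of_linear_growth {γ γ' : ℝ → ℝ} {T C R t₀ : ℝ} (hC : 0 ≤ C)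
    (ht₀ : t₀ ∈ Icc (-T) T) (hR : |γ t₀| ≤ R)
    (hγ : ∀ t ∈ Icc (-T) T, HasDerivWithinAt γ (γ' t) (Icc (-T) T) t)
    (hγ' : ∀ t ∈ Icc (-T) T, |γ' t| ≤ C * (1 + |γ t|)) {t : ℝ} (ht : t ∈ Icc (-T) T) :
    |γ t| ≤ 1 + (1 + R ^ 2) * Real.exp (4 * C * (2 * T)) := by
  have hpos : ∀ s, 0 < 1 + γ s ^ 2 := fun s => by positivity
  have hlog : ∀ s ∈ Icc (-T) T, HasDerivWithinAt (fun s => Real.log (1 + γ s ^ 2))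
      (2 * γ s * γ' s / (1 + γ s ^ 2)) (Icc (-T) T) s := fun s hs => by
    convert! (((hγ s hs).pow 2).const_add 1).log (hpos s).ne' using 1
    simp
  have hbd : ∀ s ∈ Icc (-T) T, ‖2 * γ s * γ' s / (1 + γ s ^ 2)‖ ≤ 4 * C := fun s hs => by
    rw [Real.norm_eq_abs, abs_div, abs_of_pos (hpos s), div_le_iff₀ (hpos s), abs_mul, abs_mul,
      abs_two, ← sq_abs (γ s)]
    have h1 := mul_le_mul_of_nonneg_left (hγ' s hs) (abs_nonneg (γ s))
    nlinarith [mul_nonneg hC (sq_nonneg (|γ s| - 1)), mul_nonneg hC (abs_nonneg (γ s))]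
  have key := (convex_Icc (-T) T).norm_image_sub_le_of_norm_hasDerivWithin_le hlog hbd ht₀ ht
  have hdist : ‖t - t₀‖ ≤ 2 * T := by
    rw [Real.norm_eq_abs, abs_le]
    constructor <;> linarith [ht.1, ht.2, ht₀.1, ht₀.2]
  have h2 : Real.log (1 + γ t ^ 2) ≤ Real.log (1 + γ t₀ ^ 2) + 4 * C * (2 * T) := by
    have := (le_abs_self _).trans (key.trans (mul_le_mul_of_nonneg_left hdist (by positivity)))
    linarith
  have h3 : 1 + γ t ^ 2 ≤ (1 + γ t₀ ^ 2) * Real.exp (4 * C * (2 * T)) := by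
    have := Real.exp_le_exp.2 h2
    rwa [Real.exp_add, Real.exp_log (hpos _), Real.exp_log (hpos _)] at this
  have h4 : γ t₀ ^ 2 ≤ R ^ 2 := sq_le_sq' (abs_le.1 hR).1 (abs_le.1 hR).2
  have h5 : (1 + γ t₀ ^ 2) * Real.exp (4 * C * (2 * T)) ≤
      (1 + R ^ 2) * Real.exp (4 * C * (2 * T)) := by gcongr
  nlinarith [sq_abs (γ t), sq_nonneg (|γ t| - 1)]

theorem exists_lipschitzOnWith {f : ℝ → ℝ → ℝ}
    (hf : ContDiff ℝ 1 (fun p : ℝ × ℝ => f p.1 p.2)) (T M : ℝ) :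
    ∃ K : ℝ≥0, ∀ t ∈ Icc (-T) T, LipschitzOnWith K (f t) (Icc (-M) M) := by
  obtain ⟨A, hA, hAf, -⟩ := exists_continuous_slope hf
  obtain ⟨K, hK⟩ :=
    (isCompact_Icc.prod (isCompact_Icc.prod isCompact_Icc)).exists_bound_of_continuousOn
      (s := Icc (-T) T ×ˢ Icc (-M) M ×ˢ Icc (-M) M) hA.continuousOn
  refine ⟨K.toNNReal, fun t ht => LipschitzOnWith.of_dist_le_mul fun p hp q hq => ?_⟩
  rw [Real.dist_eq, Real.dist_eq, hAf, abs_mul]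
  gcongr
  exact (hK (t, p, q) ⟨ht, hp, hq⟩).trans (Real.le_coe_toNNReal K)

/-- Existence on a compact time interval. -/
theorem exists_solution_Icc {f : ℝ → ℝ → ℝ} (hf : ContDiff ℝ 1 (fun p : ℝ × ℝ => f p.1 p.2))
    (hg : LinearGrowth f) {T t₀ : ℝ} (ht₀ : t₀ ∈ Icc (-T) T) (x₀ : ℝ) :
    ∃ γ : ℝ → ℝ, γ t₀ = x₀ ∧
      ∀ t ∈ Icc (-T) T, HasDerivWithinAt γ (f t (γ t)) (Icc (-T) T) t := by
  have hT : 0 ≤ T := by linarith [ht₀.1, ht₀.2]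
  obtain ⟨C, hC, hCf⟩ := hg T
  set M := 1 + (1 + |x₀| ^ 2) * Real.exp (4 * C * (2 * T)) with hM
  have hM0 : 0 ≤ M := by positivity
  have hMM : -M ≤ M := by linarith
  obtain ⟨K, hK⟩ := exists_lipschitzOnWith hf T M
  let c : ℝ → ℝ := fun x => projIcc (-M) M hMM x
  have hcl : LipschitzWith 1 c := LipschitzWith.projIcc hMM
  have hcm : ∀ x, c x ∈ Icc (-M) M := fun x => (projIcc (-M) M hMM x).2
  have hcx : ∀ x ∈ Icc (-M) M, c x = x := fun x hx => by
    simp only [c, projIcc_of_mem hMM hx]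
  have hcabs : ∀ x, |c x| ≤ |x| := fun x => by
    have := hcl.dist_le_mul x 0
    rw [hcx 0 ⟨by linarith, hM0⟩] at this
    simpa using this
  have hfb : ∀ t ∈ Icc (-T) T, ∀ x, |f t (c x)| ≤ C * (1 + |x|) := fun t ht x =>
    (hCf t (c x) ht).trans (by have := hcabs x; gcongr)
  let L : ℝ≥0 := ⟨C * (1 + M), by positivity⟩
  let S : ℝ≥0 := ⟨2 * T, by positivity⟩
  have hpl : IsPicardLindelof (fun t x => f t (c x)) ⟨t₀, ht₀⟩ x₀ (L * S) 0 L (K * 1) :=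
    { lipschitzOnWith := fun t ht =>
        (hK t ht).comp hcl.lipschitzOnWith (fun x _ => hcm x)
      continuousOn := fun x _ =>
        (hf.continuous.comp (f := fun t => (t, c x)) (by fun_prop)).continuousOn
      norm_le := fun t ht x _ => (hCf t (c x) ht).trans (by
        have := abs_le.2 (hcm x)
        change _ ≤ C * (1 + M)
        gcongr)
      mul_max_le := by
        rw [NNReal.coe_zero, sub_zero, NNReal.coe_mul]
        refine mul_le_mul_of_nonneg_left (max_le ?_ ?_) L.2
        · change T - t₀ ≤ 2 * T
          linarith [ht₀.1]
        · change t₀ - -T ≤ 2 * T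
          linarith [ht₀.2] }
  obtain ⟨γ, h0, hγ⟩ := hpl.exists_eq_forall_mem_Icc_hasDerivWithinAt₀
  refine ⟨γ, h0, fun t ht => ?_⟩
  have hb := abs_le_of_linear_growth (R := |x₀|) hC ht₀ (by rw [show γ t₀ = x₀ from h0]) hγ
    (fun t ht => hfb t ht _) ht
  have := hγ t ht
  rwa [hcx (γ t) (abs_le.1 hb)] at this

theorem eqOn_of_solution_Icc {f : ℝ → ℝ → ℝ} (hf : ContDiff ℝ 1 (fun p : ℝ × ℝ => f p.1 p.2))
    {T t₀ : ℝ} (ht₀ : t₀ ∈ Ioo (-T) T) {γ δ : ℝ → ℝ} (h₀ : γ t₀ = δ t₀)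
    (hγ : ∀ t ∈ Icc (-T) T, HasDerivWithinAt γ (f t (γ t)) (Icc (-T) T) t)
    (hδ : ∀ t ∈ Icc (-T) T, HasDerivWithinAt δ (f t (δ t)) (Icc (-T) T) t) :
    EqOn γ δ (Icc (-T) T) := by
  have cγ : ContinuousOn γ (Icc (-T) T) := fun t ht => (hγ t ht).continuousWithinAt
  have cδ : ContinuousOn δ (Icc (-T) T) := fun t ht => (hδ t ht).continuousWithinAt
  obtain ⟨M₁, hM₁⟩ := isCompact_Icc.exists_bound_of_continuousOn cγ
  obtain ⟨M₂, hM₂⟩ := isCompact_Icc.exists_bound_of_continuousOn cδ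
  obtain ⟨K, hK⟩ := exists_lipschitzOnWith hf T (max M₁ M₂)
  exact ODE_solution_unique_of_mem_Icc (s := fun _ => Icc (-max M₁ M₂) (max M₁ M₂))
    (fun t ht => hK t (Ioo_subset_Icc_self ht)) ht₀ cγ
    (fun t ht => (hγ t (Ioo_subset_Icc_self ht)).hasDerivAt (Icc_mem_nhds ht.1 ht.2))
    (fun t ht => abs_le.1 ((hM₁ t (Ioo_subset_Icc_self ht)).trans (le_max_left _ _))) cδ
    (fun t ht => (hδ t (Ioo_subset_Icc_self ht)).hasDerivAt (Icc_mem_nhds ht.1 ht.2))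
    (fun t ht => abs_le.1 ((hM₂ t (Ioo_subset_Icc_self ht)).trans (le_max_right _ _))) h₀

/-- Global existence under at most linear growth. -/
theorem exists_global_solution {f : ℝ → ℝ → ℝ}
    (hf : ContDiff ℝ 1 (fun p : ℝ × ℝ => f p.1 p.2)) (hg : LinearGrowth f) (t₀ x₀ : ℝ) :
    ∃ γ : ℝ → ℝ, γ t₀ = x₀ ∧ ∀ t, HasDerivAt γ (f t (γ t)) t := by
  have hmem : ∀ t, t₀ ∈ Ioo (-(|t| + |t₀| + 1)) (|t| + |t₀| + 1) := fun t => by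
    constructor <;> linarith [neg_abs_le t₀, le_abs_self t₀, abs_nonneg t]
  have hmem' : ∀ t, t ∈ Ioo (-(|t| + |t₀| + 1)) (|t| + |t₀| + 1) := fun t => by
    constructor <;> linarith [neg_abs_le t, le_abs_self t, abs_nonneg t₀]
  choose G hG₀ hG using fun t : ℝ =>
    exists_solution_Icc hf hg (Ioo_subset_Icc_self (hmem t)) x₀
  have compat : ∀ s t, |s| ≤ |t| →
      EqOn (G s) (G t) (Icc (-(|s| + |t₀| + 1)) (|s| + |t₀| + 1)) := fun s t hst => by
    have hsub : Icc (-(|s| + |t₀| + 1)) (|s| + |t₀| + 1) ⊆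
        Icc (-(|t| + |t₀| + 1)) (|t| + |t₀| + 1) := Icc_subset_Icc (by linarith) (by linarith)
    exact eqOn_of_solution_Icc hf (hmem s) ((hG₀ s).trans (hG₀ t).symm) (hG s)
      fun r hr => (hG t r (hsub hr)).mono hsub
  have hev : ∀ t, (fun s => G s s) =ᶠ[𝓝 t] G t := fun t => by
    filter_upwards [Ioo_mem_nhds (hmem' t).1 (hmem' t).2] with s hs
    rcases le_total |s| |t| with h | h
    · exact compat s t h (Ioo_subset_Icc_self (hmem' s))
    · exact (compat t s h (Ioo_subset_Icc_self hs)).symm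
  exact ⟨fun t => G t t, hG₀ t₀, fun t =>
    (((hG t t (Ioo_subset_Icc_self (hmem' t))).hasDerivAt
      (Icc_mem_nhds (hmem' t).1 (hmem' t).2)).congr_of_eventuallyEq (hev t))⟩

section Flow

variable {f X : ℝ → ℝ → ℝ}

/-- The difference of two solutions solves a linear equation. -/
theorem sub_eq_mul_exp_of_solution {A : ℝ → ℝ → ℝ → ℝ}
    (hA : Continuous (fun p : ℝ × ℝ × ℝ => A p.1 p.2.1 p.2.2))
    (hAf : ∀ t p q, f t p - f t q = A t p q * (p - q)) {γ δ : ℝ → ℝ}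
    (hγ : ∀ t, HasDerivAt γ (f t (γ t)) t) (hδ : ∀ t, HasDerivAt δ (f t (δ t)) t) (t₀ t : ℝ) :
    γ t - δ t = (γ t₀ - δ t₀) * Real.exp (∫ s in t₀..t, A s (γ s) (δ s)) := by
  have cγ : Continuous γ := continuous_iff_continuousAt.2 fun t => (hγ t).continuousAt
  have cδ : Continuous δ := continuous_iff_continuousAt.2 fun t => (hδ t).continuousAt
  refine eq_mul_exp_of_hasDerivAt (w := fun t => γ t - δ t) (c := fun s => A s (γ s) (δ s))
    (hA.comp (f := fun s => (s, γ s, δ s)) (by fun_prop)) (fun t => ?_) t₀ t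
  rw [← hAf]
  exact (hγ t).sub (hδ t)

theorem flow_continuous (hf : ContDiff ℝ 1 (fun p : ℝ × ℝ => f p.1 p.2)) (hg : LinearGrowth f)
    (hX₀ : ∀ x, X 0 x = x) (hX : ∀ t x, HasDerivAt (fun s => X s x) (f t (X t x)) t) :
    Continuous (fun p : ℝ × ℝ => X p.1 p.2) := by
  obtain ⟨A, hA, hAf, -⟩ := exists_continuous_slope hf
  refine continuous_iff_continuousAt.2 fun ⟨t₀, x₀⟩ => ?_
  set T := |t₀| + 1 with hT
  set R := |x₀| + 1 with hR
  have hT0 : 0 ≤ T := by positivity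
  obtain ⟨C, hC, hCf⟩ := hg T
  set M := 1 + (1 + R ^ 2) * Real.exp (4 * C * (2 * T)) with hM
  have hXM : ∀ t ∈ Icc (-T) T, ∀ x ∈ Icc (-R) R, X t x ∈ Icc (-M) M := fun t ht x hx =>
    abs_le.1 <| abs_le_of_linear_growth (γ := fun s => X s x) (t₀ := 0) hC ⟨by linarith, hT0⟩
      (by simpa [hX₀] using abs_le.2 hx) (fun s _ => (hX s x).hasDerivWithinAt)
      (fun s hs => hCf s _ hs) ht
  obtain ⟨K, hK⟩ :=
    (isCompact_Icc.prod (isCompact_Icc.prod isCompact_Icc)).exists_bound_of_continuousOn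
      (s := Icc (-T) T ×ˢ Icc (-M) M ×ˢ Icc (-M) M) hA.continuousOn
  have hlip : ∀ t ∈ Icc (-T) T,
      LipschitzOnWith (Real.exp (K * T)).toNNReal (X t) (Icc (-R) R) := fun t ht => by
    refine LipschitzOnWith.of_dist_le_mul fun x hx y hy => ?_
    rw [Real.dist_eq, Real.dist_eq, Real.coe_toNNReal _ (Real.exp_pos _).le,
      sub_eq_mul_exp_of_solution hA hAf (fun t => hX t x) (fun t => hX t y) 0 t, hX₀, hX₀,
      abs_mul, Real.abs_exp, mul_comm]
    gcongr
    have hsub : uIoc 0 t ⊆ Icc (-T) T := fun s hs => by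
      rcases mem_uIoc.1 hs with h | h
      · exact ⟨by linarith [h.1], h.2.trans ht.2⟩
      · exact ⟨ht.1.trans h.1.le, by linarith [h.2]⟩
    have hb := intervalIntegral.norm_integral_le_of_norm_le_const
      (f := fun s => A s (X s x) (X s y)) (a := 0) (b := t) (C := K) fun s hs =>
        hK (s, X s x, X s y) ⟨hsub hs, hXM s (hsub hs) x hx, hXM s (hsub hs) y hy⟩
    have hK0 : 0 ≤ K := (norm_nonneg _).trans
      (hK (t, X t x, X t y) ⟨ht, hXM t ht x hx, hXM t ht y hy⟩)
    refine (le_abs_self _).trans (hb.trans (mul_le_mul_of_nonneg_left ?_ hK0))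
    simpa using abs_le.2 ht
  have hcont := continuousOn_prod_of_continuousOn_lipschitzOnWith'
    (fun p : ℝ × ℝ => X p.1 p.2) (s := Icc (-T) T) (t := Icc (-R) R) _ hlip
    fun x _ t _ => (hX t x).continuousAt.continuousWithinAt
  refine hcont.continuousAt (prod_mem_nhds (Icc_mem_nhds ?_ ?_) (Icc_mem_nhds ?_ ?_)) <;>
    linarith [neg_abs_le t₀, le_abs_self t₀, neg_abs_le x₀, le_abs_self x₀]

theorem flow_hasDerivAt_snd (hf : ContDiff ℝ 1 (fun p : ℝ × ℝ => f p.1 p.2))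
    (hc : Continuous (fun p : ℝ × ℝ => X p.1 p.2))
    (hX₀ : ∀ x, X 0 x = x) (hX : ∀ t x, HasDerivAt (fun s => X s x) (f t (X t x)) t) (t x : ℝ) :
    HasDerivAt (X t) (Real.exp (∫ s in (0 : ℝ)..t, deriv (f s) (X s x))) x := by
  obtain ⟨A, hA, hAf, hAd⟩ := exists_continuous_slope hf
  have hexp : Continuous fun y => Real.exp (∫ s in (0 : ℝ)..t, A s (X s y) (X s x)) := by
    refine Real.continuous_exp.comp
      (intervalIntegral.continuous_parametric_intervalIntegral_of_continuous'
        (f := fun y s => A s (X s y) (X s x)) ?_ _ _)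
    exact hA.comp (f := fun q : ℝ × ℝ => (q.2, X q.2 q.1, X q.2 x))
      (continuous_snd.prodMk ((hc.comp (continuous_snd.prodMk continuous_fst)).prodMk
        (hc.comp (continuous_snd.prodMk continuous_const))))
  rw [hasDerivAt_iff_tendsto_slope]
  have hlim := (hexp.tendsto x).mono_left (nhdsWithin_le_nhds (s := {x}ᶜ))
  simp only [hAd] at hlim
  refine hlim.congr' ?_
  filter_upwards [self_mem_nhdsWithin] with y hy
  have hne : y - x ≠ 0 := sub_ne_zero.2 hy
  rw [slope_def_field,
    sub_eq_mul_exp_of_solution hA hAf (fun t => hX t y) (fun t => hX t x) 0 t, hX₀, hX₀]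
  field_simp

theorem flow_contDiff (hf : ContDiff ℝ (⊤ : ℕ∞) (fun p : ℝ × ℝ => f p.1 p.2))
    (hg : LinearGrowth f) (hX₀ : ∀ x, X 0 x = x)
    (hX : ∀ t x, HasDerivAt (fun s => X s x) (f t (X t x)) t) :
    ContDiff ℝ (⊤ : ℕ∞) (fun p : ℝ × ℝ => X p.1 p.2) := by
  have hf1 : ContDiff ℝ 1 (fun p : ℝ × ℝ => f p.1 p.2) := hf.of_le (by exact_mod_cast le_top)
  have hc := flow_continuous hf1 hg hX₀ hX
  rw [contDiff_infty] at hf ⊢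
  intro n
  induction n with
  | zero => exact contDiff_zero.2 hc
  | succ n ih =>
    refine contDiff_succ_of_partials hX (flow_hasDerivAt_snd hf1 hc hX₀ hX)
      ((hf n).comp (contDiff_fst.prodMk ih)) (ContDiff.exp ?_)
    refine contDiff_primitive (g := fun s x => deriv (f s) (X s x)) ?_
    exact (contDiff_deriv_snd (m := n) (hf (n + 1)) (by simp)).comp (contDiff_fst.prodMk ih)

end Flow

/-- A one-parameter family of diffeomorphisms of the line has a jointly smooth inverse. -/
theorem exists_contDiff_inverse_family {n : WithTop ℕ∞} (hn : 1 ≤ n) {X : ℝ → ℝ → ℝ}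
    (hX : ContDiff ℝ n (fun p : ℝ × ℝ => X p.1 p.2)) (hb : ∀ t, Function.Bijective (X t))
    (hd : ∀ t x, pdx X t x ≠ 0) :
    ∃ Z : ℝ → ℝ → ℝ, ContDiff ℝ n (fun p : ℝ × ℝ => Z p.1 p.2) ∧
      (∀ t x, Z t (X t x) = x) ∧ ∀ t y, X t (Z t y) = y := by
  choose Z hZl hZr using fun t => Function.bijective_iff_has_inverse.1 (hb t)
  refine ⟨Z, ?_, hZl, hZr⟩
  have h : ContDiff ℝ n (fun p : ℝ × ℝ => (p.1, Z p.1 p.2)) := by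
    refine contDiff_inverse (Φ := fun p : ℝ × ℝ => (p.1, X p.1 p.2)) (by rintro rfl; simp at hn)
      (contDiff_fst.prodMk hX) (fun p => by simp [hZl p.1 p.2]) (fun p => by simp [hZr p.1 p.2])
      fun p => ?_
    have hX1 : ContDiff ℝ 1 (fun p : ℝ × ℝ => X p.1 p.2) := hX.of_le hn
    set D := fderiv ℝ (fun p : ℝ × ℝ => X p.1 p.2) p with hD
    have hDx : D (0, 1) ≠ 0 := (hasDerivAt_snd_fderiv hX1 p.1 p.2).deriv ▸ hd p.1 p.2
    let L : ℝ × ℝ →L[ℝ] ℝ × ℝ := (ContinuousLinearMap.fst ℝ ℝ ℝ).prod D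
    have hker : LinearMap.ker (L : ℝ × ℝ →ₗ[ℝ] ℝ × ℝ) = ⊥ := by
      rw [LinearMap.ker_eq_bot']
      rintro ⟨r, s⟩ hrs
      have h1 : r = 0 := congrArg Prod.fst hrs
      have h2 : D (r, s) = 0 := congrArg Prod.snd hrs
      have h3 : ((r, s) : ℝ × ℝ) = s • (0, 1) := by simp [h1]
      rw [h3, map_smul, smul_eq_mul, mul_eq_zero, or_iff_left hDx] at h2
      simp [h1, h2]
    refine ⟨(LinearEquiv.ofInjectiveEndo (L : ℝ × ℝ →ₗ[ℝ] ℝ × ℝ)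
      (LinearMap.ker_eq_bot.1 hker)).toContinuousLinearEquiv, ?_⟩
    convert! hasFDerivAt_fst.prodMk ((hX1.differentiable one_ne_zero) p).hasFDerivAt using 1
  exact contDiff_snd.comp h

theorem stmt9 (a b : ℝ → ℝ → ℝ)
    (ha : ContDiff ℝ (⊤ : ℕ∞) (fun p : ℝ × ℝ => a p.1 p.2))
    (hb : ContDiff ℝ (⊤ : ℕ∞) (fun p : ℝ × ℝ => b p.1 p.2))
    (hgrowth : ∀ T : ℝ, 0 < T → ∃ C : ℝ, 0 < C ∧
      ∀ t x : ℝ, t ∈ Set.Icc (-T) T → 1 ≤ |x| → |a t x| ≤ C * |x|)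
    (ψ : ℝ → ℝ) (hψ : ContDiff ℝ (⊤ : ℕ∞) ψ) :
    ∃ u : ℝ → ℝ → ℝ,
      (ContDiff ℝ (⊤ : ℕ∞) (fun p : ℝ × ℝ => u p.1 p.2) ∧
        (∀ t x : ℝ, pdt u t x = a t x * pdx u t x + b t x * u t x) ∧
        (∀ x : ℝ, u 0 x = ψ x)) ∧
      (∀ v : ℝ → ℝ → ℝ,
        ContDiff ℝ (⊤ : ℕ∞) (fun p : ℝ × ℝ => v p.1 p.2) →
        (∀ t x : ℝ, pdt v t x = a t x * pdx v t x + b t x * v t x) →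
        (∀ x : ℝ, v 0 x = ψ x) → v = u) ∧
      ((∀ x : ℝ, 0 < ψ x) → ∀ t x : ℝ, 0 < u t x) := by
  have h1 : (1 : WithTop ℕ∞) ≤ ((⊤ : ℕ∞) : WithTop ℕ∞) := by exact_mod_cast le_top
  let f : ℝ → ℝ → ℝ := fun t x => -a t x
  have hf : ContDiff ℝ (⊤ : ℕ∞) (fun p : ℝ × ℝ => f p.1 p.2) := ha.neg
  have hf1 : ContDiff ℝ 1 (fun p : ℝ × ℝ => f p.1 p.2) := hf.of_le h1
  have hg : LinearGrowth f := LinearGrowth.of_bound hf.continuous (by simpa [f] using hgrowth)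
  choose Y hY₀ hY using exists_global_solution hf1 hg 0
  let X : ℝ → ℝ → ℝ := fun t x => Y x t
  have hX₀ : ∀ x, X 0 x = x := hY₀
  have hX : ∀ t x, HasDerivAt (fun s => X s x) (f t (X t x)) t := fun t x => hY x t
  have hXs := flow_contDiff hf hg hX₀ hX
  obtain ⟨A, hA, hAf, -⟩ := exists_continuous_slope hf1
  have hbij : ∀ t, Function.Bijective (X t) := fun t => by
    refine ⟨fun x y hxy => ?_, fun y => ?_⟩
    · have := sub_eq_mul_exp_of_solution hA hAf (hY x) (hY y) t 0
      rw [hY₀, hY₀, show Y x t = Y y t from hxy, sub_self, zero_mul] at this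
      exact sub_eq_zero.1 this
    · obtain ⟨γ, hγt, hγ⟩ := exists_global_solution hf1 hg t y
      have := sub_eq_mul_exp_of_solution hA hAf (hY (γ 0)) hγ 0 t
      rw [hY₀, sub_self, zero_mul, hγt] at this
      exact ⟨γ 0, sub_eq_zero.1 this⟩
  obtain ⟨Z, hZ, hZX, hXZ⟩ := exists_contDiff_inverse_family h1 hXs hbij fun t x => by
    rw [pdx, (flow_hasDerivAt_snd hf1 hXs.continuous hX₀ hX t x).deriv]
    exact (Real.exp_pos _).ne'
  have hbX : ContDiff ℝ (⊤ : ℕ∞) (fun p : ℝ × ℝ => b p.1 (X p.1 p.2)) :=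
    hb.comp (contDiff_fst.prodMk hXs)
  have hbXc : ∀ x, Continuous fun s => b s (X s x) := fun x =>
    hbX.continuous.comp (f := fun s => (s, x)) (by fun_prop)
  let w : ℝ → ℝ → ℝ := fun t x => ψ x * Real.exp (∫ s in (0 : ℝ)..t, b s (X s x))
  have hw : ContDiff ℝ (⊤ : ℕ∞) (fun p : ℝ × ℝ => w p.1 p.2) := by
    refine (hψ.comp contDiff_snd).mul (ContDiff.exp ?_)
    rw [contDiff_infty] at hbX ⊢
    exact fun n => contDiff_primitive (g := fun s x => b s (X s x)) (hbX n)
  have hwd : ∀ t x, HasDerivAt (fun s => w s x) (b t (X t x) * w t x) t := fun t x => by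
    convert! ((intervalIntegral.integral_hasDerivAt_right ((hbXc x).intervalIntegrable _ _)
      ((hbXc x).stronglyMeasurableAtFilter _ _) (hbXc x).continuousAt).exp).const_mul (ψ x) using 1
    simp only [w]
    ring
  let u : ℝ → ℝ → ℝ := fun t y => w t (Z t y)
  have hu : ContDiff ℝ (⊤ : ℕ∞) (fun p : ℝ × ℝ => u p.1 p.2) :=
    hw.comp (contDiff_fst.prodMk hZ)
  have huX : ∀ t x, u t (X t x) = w t x := fun t x => by simp only [u, hZX]
  refine ⟨u, ⟨hu, fun t y => ?_, fun x => ?_⟩, fun v hv hveq hv0 => ?_, fun hpos t x =>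
    mul_pos (hpos _) (Real.exp_pos _)⟩
  · obtain ⟨x, rfl⟩ := (hbij t).surjective y
    have hd := hasDerivAt_along (hu.of_le h1) (hX t x)
    simp only [huX] at hd
    have := hd.unique (hwd t x)
    rw [huX]
    simp only [f] at this
    linarith
  · have := huX 0 x
    rw [hX₀] at this
    simpa [w] using this
  · ext t y
    obtain ⟨x, rfl⟩ := (hbij t).surjective y
    have hvd : ∀ t, HasDerivAt (fun s => v s (X s x)) (b t (X t x) * v t (X t x)) t := fun t => by
      convert! hasDerivAt_along (hv.of_le h1) (hX t x) using 1
      rw [hveq]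
      simp only [f]
      ring
    rw [huX, eq_mul_exp_of_hasDerivAt (hbXc x) hvd 0 t, hX₀, hv0]
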